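/- Let π be a μ-projective unitary representation of a countable discrete group G on a complex separable Hilbert space H such that the set B_π of Bessel vectors of π is dense in H, and let x, y ∈ H. Then x and y are π-orthogonal if and only if ⟨x, T y⟩ = 0 for every T in the commutant π(G)' (equivalently, the closed subspaces [π(G)'x] and [π(G)'y] are orthogonal). -/

import Mathlib

open scoped InnerProductSpace

noncomputable section

variable {G : Type*} {H : Type*} [NormedAddCommGroup H] [InnerProductSpace ℂ H]

/-- `π` is a projective unitary representation of `G` on `H` with multiplier `mu`:
each `π g` is a unitary operator (a surjective linear isometry) and
`π g ∘ π h = mu g h • π (g * h)`, where `|mu g h| = 1`. -/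
def IsProjUnitaryRep [Group G] (mu : G → G → ℂ) (π : G → H →L[ℂ] H) : Prop :=
  (∀ g h, ‖mu g h‖ = 1) ∧
  (∀ g, (∀ x : H, ‖π g x‖ = ‖x‖) ∧ Function.Surjective (π g)) ∧
  (∀ g h, (π g).comp (π h) = mu g h • π (g * h))

/-- `π` is a unitary representation of `G` on `H`. -/
def IsUnitaryRep [Group G] (π : G → H →L[ℂ] H) : Prop :=
  (∀ g, (∀ x : H, ‖π g x‖ = ‖x‖) ∧ Function.Surjective (π g)) ∧
  (∀ g h, (π g).comp (π h) = π (g * h))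

/-- `ξ` is a Bessel vector for `π`: `∑_g |⟨x, π g ξ⟩|² ≤ B‖x‖²` for all `x ∈ H`
(expressed via finite partial sums). -/
def IsBesselVector (π : G → H →L[ℂ] H) (ξ : H) : Prop :=
  ∃ B : ℝ, 0 < B ∧ ∀ x : H, ∀ s : Finset G, ∑ g ∈ s, ‖⟪x, π g ξ⟫_ℂ‖ ^ 2 ≤ B * ‖x‖ ^ 2

/-- `{π g ξ}_{g ∈ G}` satisfies the frame inequalities
`A‖x‖² ≤ ∑_g |⟨x, π g ξ⟩|² ≤ B‖x‖²` for all `x` in the set `M`. -/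
def IsFrameOn (π : G → H →L[ℂ] H) (ξ : H) (M : Set H) : Prop :=
  ∃ A B : ℝ, 0 < A ∧ A ≤ B ∧ ∀ x ∈ M,
    Summable (fun g : G => ‖⟪x, π g ξ⟫_ℂ‖ ^ 2) ∧
    A * ‖x‖ ^ 2 ≤ ∑' g : G, ‖⟪x, π g ξ⟫_ℂ‖ ^ 2 ∧
    ∑' g : G, ‖⟪x, π g ξ⟫_ℂ‖ ^ 2 ≤ B * ‖x‖ ^ 2

/-- The closed linear span of the orbit `{π g ξ : g ∈ G}`. -/
def orbitSpan (π : G → H →L[ℂ] H) (ξ : H) : Set H :=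
  closure (Submodule.span ℂ (Set.range fun g : G => π g ξ) : Set H)

/-- `{π g ξ}_{g ∈ G}` is a frame sequence: a frame for its closed linear span. -/
def IsFrameSequence (π : G → H →L[ℂ] H) (ξ : H) : Prop :=
  IsFrameOn π ξ (orbitSpan π ξ)

/-- `ξ` is a complete frame vector for `π`: `{π g ξ}_{g ∈ G}` is a frame for `H`. -/
def IsCompleteFrameVector (π : G → H →L[ℂ] H) (ξ : H) : Prop :=
  IsFrameOn π ξ Set.univ

/-- `{π g ξ}_{g ∈ G}` is a Parseval frame on the set `M`:
`∑_g |⟨x, π g ξ⟩|² = ‖x‖²` for all `x ∈ M`. -/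
def IsParsevalFrameOn (π : G → H →L[ℂ] H) (ξ : H) (M : Set H) : Prop :=
  ∀ x ∈ M, HasSum (fun g : G => ‖⟪x, π g ξ⟫_ℂ‖ ^ 2) (‖x‖ ^ 2)

/-- `{π g η}_{g ∈ G}` is a Riesz sequence:
`A ∑ |c g|² ≤ ‖∑ c g • π g η‖² ≤ B ∑ |c g|²` for all finitely supported `c`. -/
def IsRieszSequence (π : G → H →L[ℂ] H) (η : H) : Prop :=
  ∃ A B : ℝ, 0 < A ∧ A ≤ B ∧ ∀ c : G →₀ ℂ,
    A * ∑ g ∈ c.support, ‖c g‖ ^ 2 ≤ ‖∑ g ∈ c.support, c g • π g η‖ ^ 2 ∧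
    ‖∑ g ∈ c.support, c g • π g η‖ ^ 2 ≤ B * ∑ g ∈ c.support, ‖c g‖ ^ 2

/-- The commutant `S' = {T : T A = A T for all A ∈ S}` of a set `S` of operators. -/
def commutant (S : Set (H →L[ℂ] H)) : Set (H →L[ℂ] H) := Set.centralizer S

/-- `(π, σ)` is a commuting pair: `π(G)' = σ(G)''`. -/
def IsCommutingPair (π σ : G → H →L[ℂ] H) : Prop :=
  commutant (Set.range π) = commutant (commutant (Set.range σ))

end

/-- `x` and `y` are `π`-orthogonal: the ranges of the analysis operators `Θ_x` and `Θ_y`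
are orthogonal in `ℓ²(G)`, i.e. `⟨Θ_x a, Θ_y b⟩ = 0` for all `a ∈ D(Θ_x)`, `b ∈ D(Θ_y)`. -/
def PiOrthogonal {G : Type*} {H : Type*} [NormedAddCommGroup H] [InnerProductSpace ℂ H]
    (π : G → H →L[ℂ] H) (x y : H) : Prop :=
  ∀ a b : H, Summable (fun g : G => ‖⟪a, π g x⟫_ℂ‖ ^ 2) →
    Summable (fun g : G => ‖⟪b, π g y⟫_ℂ‖ ^ 2) →
    ∑' g : G, (starRingEnd ℂ) ⟪a, π g x⟫_ℂ * ⟪b, π g y⟫_ℂ = 0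

/-- `A` is the bounded analysis operator `x ↦ (⟪π g a, x⟫)_g` of the vector `a`. -/
def IsAnalysisOperator {G : Type*} {H : Type*} [NormedAddCommGroup H] [InnerProductSpace ℂ H]
    (π : G → H →L[ℂ] H) (a : H) (A : H →L[ℂ] lp (fun _ : G => ℂ) 2) : Prop :=
  ∀ x g, A x g = ⟪π g a, x⟫_ℂ

/-- The graph of the (possibly unbounded) analysis operator `a ↦ (⟪π g x, a⟫)_g`. -/
def analysisGraph {G : Type*} {H : Type*} [NormedAddCommGroup H] [InnerProductSpace ℂ H]
    (π : G → H →L[ℂ] H) (x : H) : Submodule ℂ (WithLp 2 (H × lp (fun _ : G => ℂ) 2)) where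
  carrier := {p | ∀ g, p.snd g = ⟪π g x, p.fst⟫_ℂ}
  add_mem' {p q} hp hq g := by
    exact (congrArg₂ (· + ·) (hp g) (hq g)).trans (inner_add_right _ _ _).symm
  zero_mem' g := by simp
  smul_mem' c p hp g := by
    exact (congrArg (c * ·) (hp g)).trans (inner_smul_right _ _ _).symm

section ProjectiveRepresentations

variable {G : Type*} {H : Type*} [NormedAddCommGroup H] [InnerProductSpace ℂ H]
  {π : G → H →L[ℂ] H} {x y a b : H}

theorem mem_analysisGraph {p : WithLp 2 (H × lp (fun _ : G => ℂ) 2)} :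
    p ∈ analysisGraph π x ↔ ∀ g, p.snd g = ⟪π g x, p.fst⟫_ℂ := Iff.rfl

theorem isClosed_analysisGraph (π : G → H →L[ℂ] H) (x : H) :
    IsClosed (analysisGraph π x : Set (WithLp 2 (H × lp (fun _ : G => ℂ) 2))) := by
  have h : (analysisGraph π x : Set (WithLp 2 (H × lp (fun _ : G => ℂ) 2))) =
      ⋂ g, {p | p.snd g = ⟪π g x, p.fst⟫_ℂ} := by
    ext p
    simp [mem_analysisGraph]
  rw [h]
  refine isClosed_iInter fun g => isClosed_eq ?_ ?_
  · exact (lp.evalCLM ℂ (fun _ : G => ℂ) 2 g).continuous.comp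
      (WithLp.sndL 2 ℂ H (lp (fun _ : G => ℂ) 2)).continuous
  · exact continuous_const.inner (WithLp.fstL 2 ℂ H (lp (fun _ : G => ℂ) 2)).continuous

instance [CompleteSpace H] : CompleteSpace (analysisGraph π x) :=
  (isClosed_analysisGraph π x).completeSpace_coe

theorem inner_mul_mul_of_norm_eq_one {m : ℂ} (hm : ‖m‖ = 1) (z w : ℂ) :
    ⟪m * z, m * w⟫_ℂ = ⟪z, w⟫_ℂ := by
  rw [← smul_eq_mul, ← smul_eq_mul, inner_smul_left, inner_smul_right, ← mul_assoc,
    RCLike.conj_mul, hm]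
  simp

theorem memℓp_two_iff {f : G → ℂ} : Memℓp f 2 ↔ Summable fun g => ‖f g‖ ^ 2 := by
  rw [memℓp_gen_iff (by simp)]
  simp

theorem summable_of_mem_analysisGraph {p : WithLp 2 (H × lp (fun _ : G => ℂ) 2)}
    (hp : p ∈ analysisGraph π x) : Summable fun g => ‖⟪p.fst, π g x⟫_ℂ‖ ^ 2 := by
  simpa only [norm_inner_symm p.fst, ← mem_analysisGraph.1 hp] using
    memℓp_two_iff.1 (lp.memℓp p.snd)

theorem exists_mem_analysisGraph (h : Summable fun g => ‖⟪a, π g x⟫_ℂ‖ ^ 2) :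
    ∃ p ∈ analysisGraph π x, p.fst = a := by
  have h' : Memℓp (fun g => ⟪π g x, a⟫_ℂ) 2 :=
    memℓp_two_iff.2 (by simpa only [norm_inner_symm] using h)
  exact ⟨WithLp.toLp 2 (a, ⟨_, h'⟩), fun g => rfl, rfl⟩

/-- The `ℓ²` pairing of two points of analysis graphs as the series in `PiOrthogonal`. -/
theorem inner_snd_eq_tsum {p q : WithLp 2 (H × lp (fun _ : G => ℂ) 2)}
    (hp : p ∈ analysisGraph π x) (hq : q ∈ analysisGraph π y) :
    ⟪q.snd, p.snd⟫_ℂ =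
      ∑' g, (starRingEnd ℂ) ⟪p.fst, π g x⟫_ℂ * ⟪q.fst, π g y⟫_ℂ := by
  rw [lp.inner_eq_tsum]
  refine tsum_congr fun g => ?_
  rw [mem_analysisGraph.1 hp g, mem_analysisGraph.1 hq g, RCLike.inner_apply, inner_conj_symm,
    inner_conj_symm]

theorem IsBesselVector.exists_analysisOperator (ha : IsBesselVector π a) :
    ∃ A, IsAnalysisOperator π a A := by
  obtain ⟨B, hB, h⟩ := ha
  have h' : ∀ x (s : Finset G), ∑ g ∈ s, ‖⟪π g a, x⟫_ℂ‖ ^ 2 ≤ B * ‖x‖ ^ 2 := fun x s => by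
    simpa only [norm_inner_symm] using h x s
  have hmem : ∀ x, Memℓp (fun g => ⟪π g a, x⟫_ℂ) 2 := fun x =>
    memℓp_gen' (C := B * ‖x‖ ^ 2) (by simpa using h' x)
  let L : H →ₗ[ℂ] lp (fun _ : G => ℂ) 2 :=
    { toFun := fun x => ⟨_, hmem x⟩
      map_add' := fun x y => by ext g; exact inner_add_right _ _ _
      map_smul' := fun c x => by ext g; exact inner_smul_right _ _ _ }
  refine ⟨L.mkContinuous (√B) fun x => ?_, fun x g => rfl⟩
  refine lp.norm_le_of_forall_sum_le (by simp) (by positivity) fun s => ?_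
  have hL : ∀ g, L x g = ⟪π g a, x⟫_ℂ := fun g => rfl
  simpa [hL, mul_pow, Real.sq_sqrt hB.le] using h' x s

theorem IsBesselVector.map_of_commutant [CompleteSpace H] (ha : IsBesselVector π a)
    {T : H →L[ℂ] H} (hT : ∀ g z, T (π g z) = π g (T z)) : IsBesselVector π (T a) := by
  obtain ⟨B, hB, h⟩ := ha
  refine ⟨B * (‖T.adjoint‖ ^ 2 + 1), by positivity, fun x s => ?_⟩
  have h1 := h (T.adjoint x) s
  simp only [ContinuousLinearMap.adjoint_inner_left, hT] at h1
  refine h1.trans ?_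
  rw [mul_assoc]
  gcongr
  calc ‖T.adjoint x‖ ^ 2 ≤ (‖T.adjoint‖ * ‖x‖) ^ 2 := by gcongr; exact T.adjoint.le_opNorm x
    _ ≤ (‖T.adjoint‖ ^ 2 + 1) * ‖x‖ ^ 2 := by nlinarith [sq_nonneg ‖x‖]

theorem IsAnalysisOperator.comp_adjoint [CompleteSpace H] {A : H →L[ℂ] lp (fun _ : G => ℂ) 2}
    (hA : IsAnalysisOperator π a A) {T : H →L[ℂ] H} (hT : ∀ g z, T (π g z) = π g (T z)) :
    IsAnalysisOperator π (T a) (A ∘L T.adjoint) := fun x g => by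
  rw [ContinuousLinearMap.comp_apply, hA, ContinuousLinearMap.adjoint_inner_right, hT]

theorem mem_commutant_range_iff {T : H →L[ℂ] H} :
    T ∈ commutant (Set.range π) ↔ ∀ g z, T (π g z) = π g (T z) := by
  simp only [commutant, Set.mem_centralizer_iff, Set.forall_mem_range, ContinuousLinearMap.ext_iff,
    mul_apply_eq_comp]
  exact forall₂_congr fun _ _ => eq_comm

/-- `π`-orthogonality to `y` passes to the images of `y` under the commutant. -/
theorem PiOrthogonal.map_right [CompleteSpace H] (h : PiOrthogonal π x y)
    {T : H →L[ℂ] H} (hT : ∀ g z, T (π g z) = π g (T z)) : PiOrthogonal π x (T y) := by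
  intro a b ha hb
  have hb' : ∀ g, ⟪b, π g (T y)⟫_ℂ = ⟪T.adjoint b, π g y⟫_ℂ := fun g => by
    rw [ContinuousLinearMap.adjoint_inner_left, hT]
  simp only [hb'] at hb ⊢
  exact h a _ ha hb

variable [Group G] {mu : G → G → ℂ}

namespace IsProjUnitaryRep

theorem inner_map_map (hπ : IsProjUnitaryRep mu π) (g : G) (u v : H) :
    ⟪π g u, π g v⟫_ℂ = ⟪u, v⟫_ℂ :=
  LinearIsometry.inner_map_map ⟨(π g).toLinearMap, (hπ.2.1 g).1⟩ u v

theorem map_map (hπ : IsProjUnitaryRep mu π) (g h : G) (u : H) :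
    π g (π h u) = mu g h • π (g * h) u :=
  DFunLike.congr_fun (hπ.2.2 g h) u

theorem map_one (hπ : IsProjUnitaryRep mu π) (u : H) : π 1 u = mu 1 1 • u := by
  obtain ⟨v, rfl⟩ := (hπ.2.1 1).2 u
  simpa using hπ.map_map 1 1 v

theorem exists_inner_mul (hπ : IsProjUnitaryRep mu π) (h g : G) :
    ∃ m : ℂ, ‖m‖ = 1 ∧ ∀ u v, ⟪π g u, v⟫_ℂ = m * ⟪π (h * g) u, π h v⟫_ℂ := by
  refine ⟨(starRingEnd ℂ) (mu h g), by simpa using hπ.1 h g, fun u v => ?_⟩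
  rw [← hπ.inner_map_map h, hπ.map_map, inner_smul_left]

theorem exists_inner_inv (hπ : IsProjUnitaryRep mu π) (g : G) :
    ∃ m : ℂ, ‖m‖ = 1 ∧ ∀ u v, ⟪π g⁻¹ u, v⟫_ℂ = m * ⟪u, π g v⟫_ℂ := by
  refine ⟨(starRingEnd ℂ) (mu g g⁻¹ * mu 1 1), by simp [hπ.1], fun u v => ?_⟩
  rw [← hπ.inner_map_map g, hπ.map_map, mul_inv_cancel, hπ.map_one, smul_smul, inner_smul_left]

theorem tsum_inner_map (hπ : IsProjUnitaryRep mu π) (h : G) (x y c d : H) :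
    ∑' g, ⟪⟪π g x, π h c⟫_ℂ, ⟪π g y, π h d⟫_ℂ⟫_ℂ = ∑' g, ⟪⟪π g x, c⟫_ℂ, ⟪π g y, d⟫_ℂ⟫_ℂ := by
  rw [← (Equiv.mulLeft h).tsum_eq]
  refine tsum_congr fun g => ?_
  obtain ⟨m, hm, H⟩ := hπ.exists_inner_mul h g
  rw [Equiv.coe_mulLeft, H x c, H y d, inner_mul_mul_of_norm_eq_one hm]

theorem summable_inner_map (hπ : IsProjUnitaryRep mu π) (h : G) (x c : H) :
    (Summable fun g => ‖⟪π h c, π g x⟫_ℂ‖ ^ 2) ↔ Summable fun g => ‖⟪c, π g x⟫_ℂ‖ ^ 2 := by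
  rw [← (Equiv.mulLeft h).summable_iff]
  refine iff_of_eq (congrArg (Summable ·) (funext fun g => ?_))
  obtain ⟨m, hm, H⟩ := hπ.exists_inner_mul h g
  rw [Function.comp_apply, Equiv.coe_mulLeft, norm_inner_symm, norm_inner_symm c, H, norm_mul, hm,
    one_mul]

/-- Commutation with `π` of an operator whose sesquilinear form is `π`-invariant. -/
theorem commute_of_inner_map (hπ : IsProjUnitaryRep mu π) {T : H →L[ℂ] H}
    (hT : ∀ g u v, ⟪π g u, T (π g v)⟫_ℂ = ⟪u, T v⟫_ℂ) (g : G) (z : H) :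
    T (π g z) = π g (T z) := by
  refine ext_inner_left ℂ fun w => ?_
  obtain ⟨u, rfl⟩ := (hπ.2.1 g).2 w
  rw [hT, hπ.inner_map_map]

theorem summable_of_isAnalysisOperator (hπ : IsProjUnitaryRep mu π)
    {A : H →L[ℂ] lp (fun _ : G => ℂ) 2} (hA : IsAnalysisOperator π a A) (x : H) :
    Summable fun g => ‖⟪a, π g x⟫_ℂ‖ ^ 2 := by
  rw [← (Equiv.inv G).summable_iff]
  convert! memℓp_two_iff.1 (lp.memℓp (A x)) using 2 with g
  obtain ⟨m, hm, H⟩ := hπ.exists_inner_inv g⁻¹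
  rw [inv_inv] at H
  rw [Function.comp_apply, Equiv.inv_apply, hA, H, norm_mul, hm, one_mul]

variable [CompleteSpace H]

theorem adjoint_comp_commute (hπ : IsProjUnitaryRep mu π) {A B : H →L[ℂ] lp (fun _ : G => ℂ) 2}
    (hA : IsAnalysisOperator π a A) (hB : IsAnalysisOperator π b B) (g : G) (z : H) :
    (A.adjoint ∘L B) (π g z) = π g ((A.adjoint ∘L B) z) := by
  refine hπ.commute_of_inner_map (fun h u v => ?_) g z
  simp only [ContinuousLinearMap.comp_apply, ContinuousLinearMap.adjoint_inner_right,
    lp.inner_eq_tsum, hA _ _, hB _ _]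
  exact hπ.tsum_inner_map h a b u v

theorem inner_adjoint_comp (hπ : IsProjUnitaryRep mu π) {A B : H →L[ℂ] lp (fun _ : G => ℂ) 2}
    (hA : IsAnalysisOperator π a A) (hB : IsAnalysisOperator π b B) (x y : H) :
    ⟪x, (A.adjoint ∘L B) y⟫_ℂ = ∑' g, (starRingEnd ℂ) ⟪a, π g x⟫_ℂ * ⟪b, π g y⟫_ℂ := by
  rw [ContinuousLinearMap.comp_apply, ContinuousLinearMap.adjoint_inner_right, lp.inner_eq_tsum,
    ← (Equiv.inv G).tsum_eq]
  refine tsum_congr fun g => ?_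
  obtain ⟨m, hm, H⟩ := hπ.exists_inner_inv g
  rw [Equiv.inv_apply, hA, hB, H, H, inner_mul_mul_of_norm_eq_one hm, RCLike.inner_apply,
    mul_comm]

/-- The operator sending `z` to the first component of the orthogonal projection of `(z, 0)` onto
the graph of the analysis operator of `x` commutes with `π`. -/
theorem starProjection_analysisGraph_commute (hπ : IsProjUnitaryRep mu π) (x : H) (g : G) (z : H) :
    ((analysisGraph π x).starProjection (WithLp.toLp 2 (π g z, 0))).fst =
      π g ((analysisGraph π x).starProjection (WithLp.toLp 2 (z, 0))).fst := by
  set p := (analysisGraph π x).starProjection (WithLp.toLp 2 (z, 0)) with hp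
  have hpm : p ∈ analysisGraph π x := Submodule.starProjection_apply_mem _ _
  obtain ⟨q, hq, hq1⟩ := exists_mem_analysisGraph
    ((hπ.summable_inner_map g x p.fst).2 (summable_of_mem_analysisGraph hpm))
  rw [← hq1]
  congr 1
  refine Submodule.eq_starProjection_of_mem_orthogonal hq fun c hc => ?_
  obtain ⟨d, hd⟩ := (hπ.2.1 g).2 c.fst
  have hds := summable_of_mem_analysisGraph hc
  rw [← hd, hπ.summable_inner_map] at hds
  obtain ⟨e, he, rfl⟩ := exists_mem_analysisGraph hds
  have key : ⟪e, WithLp.toLp 2 (z, 0) - p⟫_ℂ = 0 :=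
    Submodule.sub_starProjection_mem_orthogonal _ e he
  have hsnd : ⟪c.snd, q.snd⟫_ℂ = ⟪e.snd, p.snd⟫_ℂ := by
    rw [lp.inner_eq_tsum, lp.inner_eq_tsum]
    simp only [mem_analysisGraph.1 hc, mem_analysisGraph.1 hq, mem_analysisGraph.1 he,
      mem_analysisGraph.1 hpm, hq1, ← hd]
    exact hπ.tsum_inner_map g x x e.fst p.fst
  rw [inner_sub_right, sub_eq_zero] at key ⊢
  simp only [WithLp.prod_inner_apply, inner_zero_right, add_zero] at key ⊢
  change ⟪c.fst, π g z⟫_ℂ = ⟪c.fst, q.fst⟫_ℂ + ⟪c.snd, q.snd⟫_ℂ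
  rw [hsnd, hq1, ← hd, hπ.inner_map_map, hπ.inner_map_map]
  exact key

/-- The Bessel vectors form a core of the analysis operator of `x`: a vector of `ℓ²` orthogonal to
the images of the Bessel vectors is orthogonal to the whole range. -/
theorem inner_snd_eq_zero (hπ : IsProjUnitaryRep mu π)
    (hdense : Dense {y : H | IsBesselVector π y}) {f : lp (fun _ : G => ℂ) 2}
    (hf : ∀ p ∈ analysisGraph π x, IsBesselVector π p.fst → ⟪f, p.snd⟫_ℂ = 0)
    {p : WithLp 2 (H × lp (fun _ : G => ℂ) 2)} (hp : p ∈ analysisGraph π x) :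
    ⟪f, p.snd⟫_ℂ = 0 := by
  set P := (analysisGraph π x).starProjection
  have hPm : ∀ w, P w ∈ analysisGraph π x := Submodule.starProjection_apply_mem _
  set v := P (WithLp.toLp 2 (0, f)) with hv
  have hvp : ∀ q ∈ analysisGraph π x, ⟪v, q⟫_ℂ = ⟪f, q.snd⟫_ℂ := fun q hq => by
    rw [hv, Submodule.inner_starProjection_left_eq_right, Submodule.starProjection_eq_self_iff.2 hq]
    simp
  let R : H →L[ℂ] H := WithLp.fstL 2 ℂ H (lp (fun _ : G => ℂ) 2) ∘L P ∘L
    (WithLp.prodContinuousLinearEquiv 2 ℂ H (lp (fun _ : G => ℂ) 2)).symm.toContinuousLinearMap ∘L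
      ContinuousLinearMap.inl ℂ H (lp (fun _ : G => ℂ) 2)
  have hR : ∀ z, R z = (P (WithLp.toLp 2 (z, 0))).fst := fun z => rfl
  have hRc : ∀ g z, R (π g z) = π g (R z) := hπ.starProjection_analysisGraph_commute x
  have hv1 : v.fst = 0 := hdense.eq_zero_of_inner_left ℂ fun a ha => by
    have h1 := hf _ (hPm (WithLp.toLp 2 (a, 0))) (hR a ▸ ha.map_of_commutant hRc)
    rw [← hvp _ (hPm _), ← Submodule.inner_starProjection_left_eq_right,
      Submodule.starProjection_eq_self_iff.2 (hPm _)] at h1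
    simpa using h1
  have hv2 : v.snd = 0 := by
    ext g
    rw [mem_analysisGraph.1 (hPm _) g, hv1]
    simp
  rw [← hvp p hp, WithLp.prod_inner_apply]
  change ⟪v.fst, _⟫_ℂ + ⟪v.snd, _⟫_ℂ = 0
  simp [hv1, hv2]

/-- Nondegeneracy of the algebra generated by the operators `A† B`, for `A`, `B` analysis operators
of Bessel vectors. -/
theorem inner_eq_zero_of_forall_adjoint_comp (hπ : IsProjUnitaryRep mu π)
    (hdense : Dense {y : H | IsBesselVector π y})
    (h : ∀ a b A B, IsAnalysisOperator π a A → IsAnalysisOperator π b B →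
      ⟪x, (A.adjoint ∘L B) y⟫_ℂ = 0) : ⟪x, y⟫_ℂ = 0 := by
  let J : Submodule ℂ H := (Submodule.span ℂ {z | ∃ a b A B, IsAnalysisOperator π a A ∧
    IsAnalysisOperator π b B ∧ z = (A.adjoint ∘L B) y})ᗮ
  have hJ : ∀ z, z ∈ J ↔ ∀ a b A B, IsAnalysisOperator π a A → IsAnalysisOperator π b B →
      ⟪z, (A.adjoint ∘L B) y⟫_ℂ = 0 := by
    intro z
    refine ⟨fun hz a b A B hA hB => (Submodule.mem_orthogonal' _ z).1 hz _
      (Submodule.subset_span ⟨a, b, A, B, hA, hB, rfl⟩), fun hz => ?_⟩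
    rw [Submodule.mem_orthogonal']
    intro u hu
    induction hu using Submodule.span_induction with
    | mem u hu =>
      obtain ⟨a, b, A, B, hA, hB, rfl⟩ := hu
      exact hz a b A B hA hB
    | zero => simp
    | add u v _ _ hu hv => rw [inner_add_right, hu, hv, add_zero]
    | smul c u _ hu => rw [inner_smul_right, hu, mul_zero]
  have hxJ : x ∈ J := (hJ x).2 h
  set j := J.starProjection y with hj
  have hjJ : j ∈ J := Submodule.starProjection_apply_mem _ _
  have hyj : y - j ∈ Jᗮ := Submodule.sub_starProjection_mem_orthogonal _
  suffices hj0 : j = 0 by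
    rw [hj0, sub_zero] at hyj
    exact Submodule.inner_right_of_mem_orthogonal hxJ hyj
  refine hdense.eq_zero_of_inner_right ℂ fun a ha => ?_
  obtain ⟨A, hA⟩ := ha.exists_analysisOperator
  set S := A.adjoint ∘L A with hS
  have hSadj : S.adjoint = S := by
    rw [hS, ContinuousLinearMap.adjoint_comp, ContinuousLinearMap.adjoint_adjoint]
  have hSJ : S j ∈ J := (hJ _).2 fun c d C D hC hD => by
    have h1 := (hJ j).1 hjJ _ _ _ _ (hC.comp_adjoint (hπ.adjoint_comp_commute hA hA)) hD
    rw [← hS, hSadj, ContinuousLinearMap.adjoint_comp, hSadj] at h1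
    rw [← hSadj, ContinuousLinearMap.adjoint_inner_left]
    exact h1
  have h0 : ⟪j, S j⟫_ℂ = 0 := by
    have h1 : ⟪j, S y⟫_ℂ = 0 := (hJ j).1 hjJ a a A A hA hA
    have h2 : ⟪j, S (y - j)⟫_ℂ = 0 := by
      rw [← ContinuousLinearMap.adjoint_inner_left, hSadj]
      exact Submodule.inner_right_of_mem_orthogonal hSJ hyj
    rwa [map_sub, inner_sub_right, h1, zero_sub, neg_eq_zero] at h2
  have hAj : A j = 0 := by
    rwa [hS, ContinuousLinearMap.comp_apply, ContinuousLinearMap.adjoint_inner_right,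
      inner_self_eq_zero] at h0
  have h1 : ⟪π 1 a, j⟫_ℂ = 0 := by rw [← hA, hAj]; rfl
  rw [hπ.map_one, inner_smul_left, mul_eq_zero, map_eq_zero] at h1
  refine h1.resolve_left fun h => ?_
  simpa [h] using hπ.1 1 1

end IsProjUnitaryRep

end ProjectiveRepresentations

/-- **Characterization of `π`-orthogonality.** For a projective unitary representation `π`
of a countable group `G` on a complex separable Hilbert space `H` with dense Bessel
vectors, `x` and `y` are `π`-orthogonal iff `⟨x, T y⟩ = 0` for all `T` in the commutant
`π(G)'` (equivalently, `[π(G)'x] ⊥ [π(G)'y]`). -/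
theorem piOrthogonal_iff_commutant
    {G : Type*} [Group G] [Countable G]
    {H : Type*} [NormedAddCommGroup H] [InnerProductSpace ℂ H] [CompleteSpace H]
    [TopologicalSpace.SeparableSpace H]
    (mu : G → G → ℂ) (π : G → H →L[ℂ] H) (hπ : IsProjUnitaryRep mu π)
    (hdense : Dense {y : H | IsBesselVector π y}) (x y : H) :
    PiOrthogonal π x y ↔ ∀ T ∈ commutant (Set.range π), ⟪x, T y⟫_ℂ = 0 := by
  simp only [mem_commutant_range_iff]
  constructor
  · intro h T hT
    refine hπ.inner_eq_zero_of_forall_adjoint_comp hdense fun a b A B hA hB => ?_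
    rw [hπ.inner_adjoint_comp hA hB]
    exact h.map_right hT a b (hπ.summable_of_isAnalysisOperator hA x)
      (hπ.summable_of_isAnalysisOperator hB (T y))
  · intro h a b ha hb
    obtain ⟨p, hp, rfl⟩ := exists_mem_analysisGraph ha
    obtain ⟨q, hq, rfl⟩ := exists_mem_analysisGraph hb
    rw [← inner_snd_eq_tsum hp hq]
    refine hπ.inner_snd_eq_zero hdense (fun p hp hpB => ?_) hp
    rw [inner_eq_zero_symm]
    refine hπ.inner_snd_eq_zero hdense (fun q hq hqB => ?_) hq
    rw [inner_eq_zero_symm, inner_snd_eq_tsum hp hq]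
    obtain ⟨A, hA⟩ := hpB.exists_analysisOperator
    obtain ⟨B, hB⟩ := hqB.exists_analysisOperator
    rw [← hπ.inner_adjoint_comp hA hB]
    exact h _ (hπ.adjoint_comp_commute hA hB)
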